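/- Let 𝒟=(D₁,D₂,D₃) be a positively oriented tangential disk triple and set α:=curv(D₁), β:=curv(D₂), γ:=curv(D₃) and κ:=√(βγ+γα+αβ). Then there exists a unique inscribed disk of T(𝒟), i.e., a unique open disk D_in(𝒟)⊂ℂ such that D_in(𝒟)⊂T(𝒟) and the closure of D_in(𝒟) meets the closure of D_j in exactly one point for each j∈{1,2,3}. Moreover, curv(D_in(𝒟))=α+β+γ+2κ. -/

import Mathlib

open MeasureTheory Filter Topology Matrix
open scoped ENNReal NNReal BigOperators

noncomputable section

/-- `D` is an open (round) disk in `ℂ`. -/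
def IsOpenDisk (D : Set ℂ) : Prop := ∃ z : ℂ, ∃ r : ℝ, 0 < r ∧ D = Metric.ball z r

/-- `D` is an open half-plane in `ℂ`. -/
def IsOpenHalfPlane (D : Set ℂ) : Prop :=
  ∃ a : ℂ, a ≠ 0 ∧ ∃ c : ℝ, D = {z : ℂ | (a * z).re < c}

/-- The center of an open disk (junk value otherwise). -/
noncomputable def diskCenter (D : Set ℂ) : ℂ :=
  Classical.epsilon fun z : ℂ => ∃ r : ℝ, 0 < r ∧ D = Metric.ball z r

/-- The radius of an open disk (junk value otherwise). -/
noncomputable def diskRadius (D : Set ℂ) : ℝ :=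
  Classical.epsilon fun r : ℝ => 0 < r ∧ ∃ z : ℂ, D = Metric.ball z r

/-- The curvature of `D`: the reciprocal of the radius for an open disk,
and `0` for a half-plane (or anything that is not an open disk). -/
noncomputable def curv (D : Set ℂ) : ℝ :=
  haveI := Classical.propDecidable (IsOpenDisk D)
  if IsOpenDisk D then (diskRadius D)⁻¹ else 0

/-- A tangential disk triple: each member is an open disk or an open half-plane
(at most one half-plane), and the closures of distinct members meet in exactly one point. -/
def IsTDT (𝒟 : Fin 3 → Set ℂ) : Prop :=
  ((∀ j, IsOpenDisk (𝒟 j)) ∨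
    (∃ j, IsOpenHalfPlane (𝒟 j) ∧ ∀ k, k ≠ j → IsOpenDisk (𝒟 k))) ∧
  ∀ j k, j ≠ k → ∃ p : ℂ, closure (𝒟 j) ∩ closure (𝒟 k) = {p}

/-- The ideal triangle `T(𝒟)`: the unique bounded connected component of
`ℂ ∖ (closure D₁ ∪ closure D₂ ∪ closure D₃)`. -/
noncomputable def idealTriangle (𝒟 : Fin 3 → Set ℂ) : Set ℂ :=
  Classical.epsilon fun T : Set ℂ =>
    Bornology.IsBounded T ∧
    ∃ z ∈ (⋃ j, closure (𝒟 j))ᶜ, T = connectedComponentIn (⋃ j, closure (𝒟 j))ᶜ z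

/-- `q_j(𝒟)`: the tangency point of the two members other than the `j`-th one. -/
noncomputable def tangencyPoint (𝒟 : Fin 3 → Set ℂ) (j : Fin 3) : ℂ :=
  Classical.epsilon fun p : ℂ => closure (𝒟 (j + 1)) ∩ closure (𝒟 (j + 2)) = {p}

/-- `𝒟` is a positively oriented tangential disk triple: the tangency points
`q₁(𝒟), q₂(𝒟), q₃(𝒟)` occur in counterclockwise order, i.e. the ideal triangle
lies to the left of its boundary oriented through `q₁(𝒟), q₂(𝒟), q₃(𝒟)` in this order. -/
def IsTDTplus (𝒟 : Fin 3 → Set ℂ) : Prop :=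
  IsTDT 𝒟 ∧
  0 < ((tangencyPoint 𝒟 1 - tangencyPoint 𝒟 0).re *
        (tangencyPoint 𝒟 2 - tangencyPoint 𝒟 0).im -
       (tangencyPoint 𝒟 1 - tangencyPoint 𝒟 0).im *
        (tangencyPoint 𝒟 2 - tangencyPoint 𝒟 0).re)

/-- `D` is an inscribed disk of the ideal triangle of `𝒟`. -/
def IsInscribedDisk (𝒟 : Fin 3 → Set ℂ) (D : Set ℂ) : Prop :=
  IsOpenDisk D ∧ D ⊆ idealTriangle 𝒟 ∧ ∀ j, ∃ p : ℂ, closure D ∩ closure (𝒟 j) = {p}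

/-- The inscribed disk `D_in(𝒟)` of the ideal triangle of `𝒟`. -/
noncomputable def Din (𝒟 : Fin 3 → Set ℂ) : Set ℂ := Classical.epsilon (IsInscribedDisk 𝒟)

/-- `Φ_j(𝒟)`: replace the `j`-th entry of `𝒟` by the inscribed disk `D_in(𝒟)`. -/
noncomputable def Phi (j : Fin 3) (𝒟 : Fin 3 → Set ℂ) : Fin 3 → Set ℂ :=
  Function.update 𝒟 j (Din 𝒟)

/-- Finite words over the alphabet `{1,2,3}` (represented by `Fin 3`). -/
abbrev Word := List (Fin 3)

/-- `𝒟_w = Φ_w(𝒟) = (Φ_{w_m} ∘ ⋯ ∘ Φ_{w_1})(𝒟)`. -/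
noncomputable def applyWord (𝒟 : Fin 3 → Set ℂ) (w : Word) : Fin 3 → Set ℂ :=
  w.foldl (fun D j => Phi j D) 𝒟

/-- The Apollonian gasket `K(𝒟)` associated with `𝒟`. -/
noncomputable def AG (𝒟 : Fin 3 → Set ℂ) : Set ℂ :=
  closure (idealTriangle 𝒟) \ ⋃ w : Word, Din (applyWord 𝒟 w)

/-- A concrete positively oriented tangential disk triple. -/
noncomputable def baseTriple : Fin 3 → Set ℂ :=
  ![{z : ℂ | 1 < z.im},
    Metric.ball (Complex.I / 2 - 1 / 2) (1 / 2),
    Metric.ball (Complex.I / 2 + 1 / 2) (1 / 2)]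

/-- `d`, the Hausdorff dimension of the Apollonian gasket
(independent of the choice of `𝒟 ∈ TDT⁺`). -/
noncomputable def dAG : ℝ := (dimH (AG baseTriple)).toReal

/-- The matrices `M₁, M₂, M₃`. -/
def Mmat : Fin 3 → Matrix (Fin 4) (Fin 4) ℝ :=
  ![!![1,0,0,0; 1,1,0,1; 1,0,1,1; 2,0,0,1],
    !![1,1,0,1; 0,1,0,0; 0,1,1,1; 0,2,0,1],
    !![1,0,1,1; 0,1,1,1; 0,0,1,0; 0,0,2,1]]

/-- `M_w := M_{w₁} ⋯ M_{w_m}` (`M_∅` is the identity matrix). -/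
def Mword (w : Word) : Matrix (Fin 4) (Fin 4) ℝ := (w.map Mmat).prod

/-- `κ(α,β,γ) := √(βγ + γα + αβ)`. -/
noncomputable def kappa (α β γ : ℝ) : ℝ := Real.sqrt (β * γ + γ * α + α * β)

/-- The row vector `(curv D₁, curv D₂, curv D₃, κ(𝒟))`. -/
noncomputable def curvVec (𝒟 : Fin 3 → Set ℂ) : Fin 4 → ℝ :=
  ![curv (𝒟 0), curv (𝒟 1), curv (𝒟 2),
    kappa (curv (𝒟 0)) (curv (𝒟 1)) (curv (𝒟 2))]

/-- The parameter space `Γ = {(g, κ(g)) : g ∈ [0,∞)³, κ(g) > 0} ⊆ [0,∞)⁴`. -/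
def Gamma : Set (Fin 4 → ℝ) :=
  {g | 0 ≤ g 0 ∧ 0 ≤ g 1 ∧ 0 ≤ g 2 ∧ g 3 = kappa (g 0) (g 1) (g 2) ∧ 0 < g 3}

/-- `Γ° := Γ ∩ (0,∞)⁴`. -/
def GammaInt : Set (Fin 4 → ℝ) := {g | g ∈ Gamma ∧ ∀ i, 0 < g i}

/-- The compact subset `Γ_ε` of `Γ`. -/
def GammaEps (ε : ℝ) : Set (Fin 4 → ℝ) :=
  {g | g 0 ∈ Set.Icc 0 ε⁻¹ ∧ g 1 ∈ Set.Icc 0 ε⁻¹ ∧ g 2 ∈ Set.Icc 0 ε⁻¹ ∧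
       g 3 = kappa (g 0) (g 1) (g 2) ∧
       ε ≤ g 1 + g 2 ∧ ε ≤ g 2 + g 0 ∧ ε ≤ g 0 + g 1}

/-- The Euclidean norm on `ℝ⁴`. -/
noncomputable def euclNorm4 (g : Fin 4 → ℝ) : ℝ := Real.sqrt (∑ i, g i ^ 2)

/-- The metric `ρ_Γ` on `Γ`: the Euclidean distance of the first three coordinates. -/
noncomputable def rhoGamma (g₁ g₂ : Fin 4 → ℝ) : ℝ :=
  Real.sqrt ((g₁ 0 - g₂ 0) ^ 2 + (g₁ 1 - g₂ 1) ^ 2 + (g₁ 2 - g₂ 2) ^ 2)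

/-- A positively oriented tangential disk triple with prescribed curvatures
`(g 0, g 1, g 2)` (junk value if none exists). -/
noncomputable def tripleOf (g : Fin 4 → ℝ) : Fin 3 → Set ℂ :=
  Classical.epsilon fun 𝒟 : Fin 3 → Set ℂ =>
    IsTDTplus 𝒟 ∧ curv (𝒟 0) = g 0 ∧ curv (𝒟 1) = g 1 ∧ curv (𝒟 2) = g 2

/-- `ℋ_Γ(g)`: the `d`-dimensional Hausdorff measure of the Apollonian gasket `K(𝒟)`
for any `𝒟 ∈ TDT⁺` whose members have curvatures `(g 0, g 1, g 2)`. -/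
noncomputable def HGamma (g : Fin 4 → ℝ) : ℝ :=
  (μH[dAG] (AG (tripleOf g))).toReal

/-- The operator norm of a `4 × 4` real matrix with respect to the Euclidean norm on `ℝ⁴`. -/
noncomputable def opNorm4 (M : Matrix (Fin 4) (Fin 4) ℝ) : ℝ :=
  sSup {t : ℝ | ∃ v : Fin 4 → ℝ, euclNorm4 v ≤ 1 ∧ t = euclNorm4 (M.mulVec v)}

/-- The set of words `I = {jⁿk : j,k ∈ S, j ≠ k, n ∈ ℕ}`. -/
def IdxI : Set Word :=
  {w | ∃ j k : Fin 3, j ≠ k ∧ ∃ n : ℕ, 0 < n ∧ w = List.replicate n j ++ [k]}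

end

/-! ### Generalized disks as vectors of Minkowski space -/

/-- The Lorentzian form on `ℝ⁴` for which generalized disks are unit spacelike vectors. -/
noncomputable def lorentz (u v : Fin 4 → ℝ) : ℝ :=
  u 0 * v 0 + u 1 * v 1 - (u 2 * v 3 + u 3 * v 2) / 2

/-- The function `k|z|² - 2⟨w, z⟩ + m` attached to the vector `(w.re, w.im, k, m)`;
the generalized disk given by the vector is the set where this function is negative. -/
noncomputable def diskFun (v : Fin 4 → ℝ) (z : ℂ) : ℝ :=
  v 2 * (z.re ^ 2 + z.im ^ 2) - 2 * (v 0 * z.re + v 1 * z.im) + v 3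

/-- The center of the disk given by a vector with positive curvature coordinate. -/
noncomputable def vecCenter (v : Fin 4 → ℝ) : ℂ := ⟨v 0 / v 2, v 1 / v 2⟩

lemma lorentz_comm (u v : Fin 4 → ℝ) : lorentz u v = lorentz v u := by
  simp only [lorentz]; ring

lemma continuous_diskFun (v : Fin 4 → ℝ) : Continuous (diskFun v) := by
  unfold diskFun; fun_prop

lemma norm_sq_eq_re_im (z : ℂ) : ‖z‖ ^ 2 = z.re ^ 2 + z.im ^ 2 := by
  rw [Complex.sq_norm, Complex.normSq_apply]; ring

lemma diskFun_eq_norm {v : Fin 4 → ℝ} (hk : 0 < v 2) (hv : lorentz v v = 1) (z : ℂ) :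
    diskFun v z = v 2 * (‖z - vecCenter v‖ ^ 2 - (v 2)⁻¹ ^ 2) := by
  simp only [lorentz] at hv
  simp only [norm_sq_eq_re_im, diskFun, vecCenter, Complex.sub_re, Complex.sub_im]
  field_simp
  linear_combination -hv

lemma setOf_diskFun_neg {v : Fin 4 → ℝ} (hk : 0 < v 2) (hv : lorentz v v = 1) :
    {z | diskFun v z < 0} = Metric.ball (vecCenter v) (v 2)⁻¹ := by
  ext z
  have hr : 0 < (v 2)⁻¹ := inv_pos.2 hk
  rw [Set.mem_ofPred_eq, diskFun_eq_norm hk hv, ← neg_pos, ← mul_neg, mul_pos_iff_of_pos_left hk,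
    neg_pos, sub_neg, sq_lt_sq₀ (norm_nonneg _) hr.le, mem_ball_iff_norm]

lemma setOf_diskFun_nonpos {v : Fin 4 → ℝ} (hk : 0 < v 2) (hv : lorentz v v = 1) :
    {z | diskFun v z ≤ 0} = Metric.closedBall (vecCenter v) (v 2)⁻¹ := by
  ext z
  have hr : 0 < (v 2)⁻¹ := inv_pos.2 hk
  rw [Set.mem_ofPred_eq, diskFun_eq_norm hk hv, ← not_lt, mul_pos_iff_of_pos_left hk, not_lt,
    sub_nonpos, sq_le_sq₀ (norm_nonneg _) hr.le, mem_closedBall_iff_norm]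

lemma curv_ball (z : ℂ) {r : ℝ} (hr : 0 < r) : curv (Metric.ball z r) = r⁻¹ := by
  have hD : IsOpenDisk (Metric.ball z r) := ⟨z, r, hr, rfl⟩
  have h : ∃ s : ℝ, 0 < s ∧ ∃ w : ℂ, Metric.ball z r = Metric.ball w s := ⟨r, hr, z, rfl⟩
  obtain ⟨hs, w, hw⟩ := Classical.epsilon_spec h
  have hd := congrArg Metric.diam hw
  rw [Metric.diam_ball_eq _ hr.le, Metric.diam_ball_eq _ hs.le] at hd
  rw [curv, if_pos hD, diskRadius]
  congr 1
  linarith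

/-- The vector `v` represents the generalized disk `D`. -/
structure RepresentsDisk (v : Fin 4 → ℝ) (D : Set ℂ) : Prop where
  unit : lorentz v v = 1
  curv_nonneg : 0 ≤ v 2
  eq_setOf : D = {z | diskFun v z < 0}
  closure_eq : closure D = {z | diskFun v z ≤ 0}
  curv_eq : curv D = v 2

lemma represents_setOf {v : Fin 4 → ℝ} (hk : 0 < v 2) (hv : lorentz v v = 1) :
    RepresentsDisk v {z | diskFun v z < 0} where
  unit := hv
  curv_nonneg := hk.le
  eq_setOf := rfl
  closure_eq := by
    rw [setOf_diskFun_neg hk hv, setOf_diskFun_nonpos hk hv,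
      closure_ball _ (inv_pos.2 hk).ne']
  curv_eq := by rw [setOf_diskFun_neg hk hv, curv_ball _ (inv_pos.2 hk), inv_inv]

lemma IsOpenDisk.exists_represents {D : Set ℂ} (hD : IsOpenDisk D) :
    ∃ v, RepresentsDisk v D ∧ 0 < v 2 := by
  obtain ⟨z, r, hr, rfl⟩ := hD
  let v : Fin 4 → ℝ := ![z.re / r, z.im / r, r⁻¹, (z.re ^ 2 + z.im ^ 2 - r ^ 2) / r]
  have hk : 0 < v 2 := inv_pos.2 hr
  have hv : lorentz v v = 1 := by
    simp [lorentz, v]; field_simp; ring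
  have hc : vecCenter v = z := by
    apply Complex.ext <;> simp [vecCenter, v, hr.ne']
  have h2 : (v 2)⁻¹ = r := inv_inv r
  refine ⟨v, ?_, hk⟩
  have := represents_setOf hk hv
  rwa [setOf_diskFun_neg hk hv, hc, h2] at this

lemma IsOpenHalfPlane.exists_represents {D : Set ℂ} (hD : IsOpenHalfPlane D) :
    ∃ v, RepresentsDisk v D ∧ v 2 = 0 := by
  obtain ⟨a, ha, c, rfl⟩ := hD
  have hn : 0 < ‖a‖ := norm_pos_iff.2 ha
  have hsq := norm_sq_eq_re_im a
  let v : Fin 4 → ℝ := ![-a.re / ‖a‖, a.im / ‖a‖, 0, -2 * c / ‖a‖]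
  have hf (z : ℂ) : diskFun v z = 2 / ‖a‖ * ((a * z).re - c) := by
    simp [diskFun, v]; ring
  refine ⟨v, ⟨?_, le_rfl, ?_, ?_, ?_⟩, rfl⟩
  · simp [lorentz, v]; field_simp; linarith
  · ext z
    rw [Set.mem_ofPred_eq, Set.mem_ofPred_eq, hf, ← neg_pos, ← mul_neg,
      mul_pos_iff_of_pos_left (by positivity), neg_pos, sub_neg]
  · have h1 : {z : ℂ | (a * z).re < c} = (Homeomorph.mulLeft₀ a ha) ⁻¹' {z : ℂ | z.re < c} := rfl
    rw [h1, ← Homeomorph.preimage_closure, Complex.closure_setOfPred_re_lt]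
    ext z
    rw [Set.mem_ofPred_eq, hf, ← not_lt, mul_pos_iff_of_pos_left (by positivity), sub_pos, not_lt]
    rfl
  · rw [curv, if_neg]
    · rfl
    rintro ⟨z, r, hr, h⟩
    have hz : z ∈ {z : ℂ | (a * z).re < c} := h ▸ Metric.mem_ball_self hr
    have hr' : (r : ℂ) ≠ 0 := by exact_mod_cast hr.ne'
    have hmem : z - (r : ℂ) * (‖a‖ / a) ∈ {z : ℂ | (a * z).re < c} := by
      have : a * (z - (r : ℂ) * (‖a‖ / a)) = a * z - ((r * ‖a‖ : ℝ) : ℂ) := by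
        push_cast; field_simp
      rw [Set.mem_ofPred_eq, this, Complex.sub_re, Complex.ofReal_re]
      have := mul_pos hr hn
      rw [Set.mem_ofPred_eq] at hz
      linarith
    rw [h, mem_ball_iff_norm] at hmem
    simp [hn.ne', abs_of_pos hr] at hmem

/-! ### Tangency -/

lemma lorentz_eq_neg_one_of_pos {u v : Fin 4 → ℝ} {D E : Set ℂ} (hu : RepresentsDisk u D)
    (hv : RepresentsDisk v E) (hk : 0 < u 2) (h : ∃ p : ℂ, closure D ∩ closure E = {p}) :
    lorentz u v = -1 := by
  obtain ⟨p, hp⟩ := h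
  have hdis : Disjoint D E := by
    rw [Set.disjoint_iff_inter_eq_empty]
    have hsub : D ∩ E ⊆ {p} := hp ▸ Set.inter_subset_inter subset_closure subset_closure
    have hop : IsOpen (D ∩ E) := by
      rw [hu.eq_setOf, hv.eq_setOf]
      exact (isOpen_lt (continuous_diskFun u) continuous_const).inter
        (isOpen_lt (continuous_diskFun v) continuous_const)
    rcases Set.subset_singleton_iff_eq.1 hsub with h0 | h0
    · exact h0
    · exact absurd (h0 ▸ hop) (not_isOpen_singleton p)
  have hpm : p ∈ closure D ∩ closure E := hp ▸ rfl
  have hr : 0 < (u 2)⁻¹ := inv_pos.2 hk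
  have hD := hu.eq_setOf.trans (setOf_diskFun_neg hk hu.unit)
  have hcD := hu.closure_eq.trans (setOf_diskFun_nonpos hk hu.unit)
  have huu := hu.unit
  have hvv := hv.unit
  simp only [lorentz] at huu hvv ⊢
  rcases hv.curv_nonneg.eq_or_lt with hk' | hk'
  · set z := vecCenter u with hz
    have hpD : p ∈ Metric.closedBall z (u 2)⁻¹ := hcD ▸ hpm.1
    have hpE : diskFun v p ≤ 0 := by
      have := hpm.2
      rwa [hv.closure_eq] at this
    have hw : v 0 ^ 2 + v 1 ^ 2 = 1 := by rw [← hk'] at hvv; linarith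
    have hle : diskFun v z ≤ 2 * (u 2)⁻¹ := by
      rw [mem_closedBall_iff_norm] at hpD
      have h1 := pow_le_pow_left₀ (norm_nonneg _) hpD 2
      rw [norm_sq_eq_re_im, Complex.sub_re, Complex.sub_im] at h1
      simp only [diskFun, ← hk'] at hpE ⊢
      have h2 : (v 0 * (p.re - z.re) + v 1 * (p.im - z.im)) ^ 2 ≤ (u 2)⁻¹ ^ 2 := by
        nlinarith [sq_nonneg (v 0 * (p.im - z.im) - v 1 * (p.re - z.re))]
      have h3 := abs_le_of_sq_le_sq' h2 hr.le
      linarith [h3.2]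
    have hge : 2 * (u 2)⁻¹ ≤ diskFun v z := by
      by_contra! hlt
      obtain ⟨t, ht, htr⟩ := exists_between
        (max_lt (show diskFun v z / 2 < (u 2)⁻¹ by linarith) hr)
      have ht0 : 0 < t := (le_max_right _ _).trans_lt ht
      have ht1 : diskFun v z / 2 < t := (le_max_left _ _).trans_lt ht
      have hq : z + ⟨t * v 0, t * v 1⟩ ∈ D := by
        rw [hD, mem_ball_iff_norm, add_sub_cancel_left, ← sq_lt_sq₀ (norm_nonneg _) hr.le,
          norm_sq_eq_re_im]
        have := pow_lt_pow_left₀ htr ht0.le two_ne_zero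
        linear_combination this + t ^ 2 * hw
      refine Set.disjoint_left.1 hdis hq ?_
      rw [hv.eq_setOf, Set.mem_ofPred_eq]
      have : diskFun v (z + ⟨t * v 0, t * v 1⟩) = diskFun v z - 2 * t := by
        simp only [diskFun, ← hk', Complex.add_re, Complex.add_im]
        linear_combination (-2 * t) * hw
      linarith
    have heq := le_antisymm hle hge
    simp only [diskFun, ← hk', hz, vecCenter] at heq
    rw [← hk']
    field_simp at heq
    have h2 : u 2 * (2 * (u 0 * v 0 + u 1 * v 1) - u 2 * v 3 + 2) = 0 := by
      linear_combination -heq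
    have := (mul_eq_zero.1 h2).resolve_left hk.ne'
    linarith
  · have hr' : 0 < (v 2)⁻¹ := inv_pos.2 hk'
    have hE := hv.eq_setOf.trans (setOf_diskFun_neg hk' hv.unit)
    have hcE := hv.closure_eq.trans (setOf_diskFun_nonpos hk' hv.unit)
    have h1 : (u 2)⁻¹ + (v 2)⁻¹ ≤ dist (vecCenter u) (vecCenter v) := by
      rw [hD, hE, disjoint_ball_ball_iff hr hr'] at hdis
      exact hdis
    have h2 : dist (vecCenter u) (vecCenter v) ≤ (u 2)⁻¹ + (v 2)⁻¹ := by
      rw [hcD, hcE] at hpm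
      exact Metric.dist_le_add_of_nonempty_closedBall_inter_closedBall ⟨p, hpm⟩
    have h3 := congrArg (· ^ 2) (le_antisymm h1 h2)
    simp only [dist_eq_norm, norm_sq_eq_re_im, Complex.sub_re, Complex.sub_im, vecCenter] at h3
    field_simp at h3
    have h4 : (2 * (u 2 * v 2)) * (u 0 * v 0 + u 1 * v 1 - (u 2 * v 3 + u 3 * v 2) / 2 + 1) = 0 := by
      linear_combination h3 + v 2 ^ 2 * huu + u 2 ^ 2 * hvv
    have := (mul_eq_zero.1 h4).resolve_left (by positivity)
    linarith

lemma lorentz_eq_neg_one {u v : Fin 4 → ℝ} {D E : Set ℂ} (hu : RepresentsDisk u D)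
    (hv : RepresentsDisk v E) (hk : 0 < u 2 ∨ 0 < v 2) (h : ∃ p : ℂ, closure D ∩ closure E = {p}) :
    lorentz u v = -1 := by
  rcases hk with hk | hk
  · exact lorentz_eq_neg_one_of_pos hu hv hk h
  · rw [lorentz_comm]
    exact lorentz_eq_neg_one_of_pos hv hu hk (by simpa only [Set.inter_comm] using h)

/-- The point of tangency of two externally tangent generalized disks. -/
noncomputable def contactPoint (u v : Fin 4 → ℝ) : ℂ :=
  ⟨(u 0 + v 0) / (u 2 + v 2), (u 1 + v 1) / (u 2 + v 2)⟩

lemma diskFun_add_diskFun {u v : Fin 4 → ℝ} (hu : lorentz u u = 1) (hv : lorentz v v = 1)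
    (huv : lorentz u v = -1) (hk : 0 < u 2 + v 2) (z : ℂ) :
    diskFun u z + diskFun v z = (u 2 + v 2) * ‖z - contactPoint u v‖ ^ 2 := by
  simp only [lorentz] at hu hv huv
  simp only [norm_sq_eq_re_im, diskFun, contactPoint, Complex.sub_re, Complex.sub_im]
  field_simp
  linear_combination - hu - hv - 2 * huv

lemma diskFun_contactPoint {u v : Fin 4 → ℝ} (hu : lorentz u u = 1) (hv : lorentz v v = 1)
    (huv : lorentz u v = -1) (hk : 0 < u 2 + v 2) : diskFun u (contactPoint u v) = 0 := by
  simp only [lorentz] at hu hv huv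
  simp only [diskFun, contactPoint]
  field_simp
  linear_combination (u 2) * (hu + hv + 2 * huv) - 2 * (u 2 + v 2) * (hu + huv)

lemma closure_inter_closure_of_lorentz {u v : Fin 4 → ℝ} {D E : Set ℂ} (hu : RepresentsDisk u D)
    (hv : RepresentsDisk v E) (hk : 0 < u 2) (h : lorentz u v = -1) :
    closure D ∩ closure E = {contactPoint u v} := by
  have hk' : 0 < u 2 + v 2 := add_pos_of_pos_of_nonneg hk hv.curv_nonneg
  have hadd := diskFun_add_diskFun hu.unit hv.unit h hk'
  have hcu := diskFun_contactPoint hu.unit hv.unit h hk'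
  rw [hu.closure_eq, hv.closure_eq]
  ext z
  simp only [Set.mem_inter_iff, Set.mem_ofPred_eq, Set.mem_singleton_iff]
  constructor
  · rintro ⟨h1, h2⟩
    have h3 : (u 2 + v 2) * ‖z - contactPoint u v‖ ^ 2 ≤ 0 := by rw [← hadd]; linarith
    have h4 : ‖z - contactPoint u v‖ ^ 2 ≤ 0 := nonpos_of_mul_nonpos_right h3 hk'
    rw [← sub_eq_zero, ← norm_eq_zero]
    exact pow_eq_zero_iff two_ne_zero |>.1 (le_antisymm h4 (sq_nonneg _))
  · rintro rfl
    have := hadd (contactPoint u v)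
    rw [hcu, sub_self, norm_zero] at this
    exact ⟨hcu.le, by linarith⟩

lemma diskFun_pos_of_lorentz {u v : Fin 4 → ℝ} (hu : lorentz u u = 1) (hv : lorentz v v = 1)
    (huv : lorentz u v = -1) (hk : 0 < u 2 + v 2) {z : ℂ} (hz : diskFun u z < 0) :
    0 < diskFun v z := by
  have := diskFun_add_diskFun hu hv huv hk z
  have : 0 ≤ (u 2 + v 2) * ‖z - contactPoint u v‖ ^ 2 := by positivity
  linarith

/-! ### Three mutually tangent disks and their common orthogonal circle -/

/-- The lift of a point of the plane to the light cone. -/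
def pointVec (z : ℂ) : Fin 4 → ℝ := ![z.re, z.im, 1, z.re ^ 2 + z.im ^ 2]

lemma lorentz_pointVec (v : Fin 4 → ℝ) (z : ℂ) : lorentz v (pointVec z) = -diskFun v z / 2 := by
  simp [lorentz, pointVec, diskFun]; ring

lemma lorentz_pointVec_self (z : ℂ) : lorentz (pointVec z) (pointVec z) = 0 := by
  simp [lorentz, pointVec]; ring

/-- The vectors `v 0, v 1, v 2` are mutually tangent generalized disks, and `n` is a generalized
disk orthogonal to all of them. -/
structure IsTangentFrame (v : Fin 3 → Fin 4 → ℝ) (n : Fin 4 → ℝ) : Prop where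
  unit : ∀ j, lorentz (v j) (v j) = 1
  tangent : ∀ j k, j ≠ k → lorentz (v j) (v k) = -1
  unit_normal : lorentz n n = 1
  orthogonal : ∀ j, lorentz (v j) n = 0

namespace IsTangentFrame

variable {v : Fin 3 → Fin 4 → ℝ} {n : Fin 4 → ℝ}

/-- The Parseval identity of a tangent frame. -/
lemma lorentz_eq (h : IsTangentFrame v n) (x y : Fin 4 → ℝ) :
    lorentz x y = (lorentz (v 0) x * lorentz (v 0) y + lorentz (v 1) x * lorentz (v 1) y +
      lorentz (v 2) x * lorentz (v 2) y - (lorentz (v 0) x + lorentz (v 1) x + lorentz (v 2) x) *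
      (lorentz (v 0) y + lorentz (v 1) y + lorentz (v 2) y)) / 2 + lorentz n x * lorentz n y := by
  let S : Matrix (Fin 4) (Fin 4) ℝ := !![1, 0, 0, 0; 0, 1, 0, 0; 0, 0, 0, -1/2; 0, 0, -1/2, 0]
  let G : Matrix (Fin 4) (Fin 4) ℝ :=
    !![0, -1/2, -1/2, 0; -1/2, 0, -1/2, 0; -1/2, -1/2, 0, 0; 0, 0, 0, 1]
  let M : Matrix (Fin 4) (Fin 4) ℝ := Matrix.of ![v 0, v 1, v 2, n]
  have hS (a b : Fin 4 → ℝ) : a ⬝ᵥ S *ᵥ b = lorentz a b := by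
    simp [S, lorentz, dotProduct, Matrix.mulVec, Fin.sum_univ_four]; ring
  have hMS (a : Fin 4 → ℝ) :
      (M * S) *ᵥ a = ![lorentz (v 0) a, lorentz (v 1) a, lorentz (v 2) a, lorentz n a] := by
    rw [← Matrix.mulVec_mulVec]
    ext i
    fin_cases i <;> exact hS _ a
  have hGram : M * S * Mᵀ = !![1, -1, -1, 0; -1, 1, -1, 0; -1, -1, 1, 0; 0, 0, 0, 1] := by
    have hcol (j : Fin 4) (i : Fin 4) : (M * S * Mᵀ) i j =
        ((M * S) *ᵥ ![v 0, v 1, v 2, n] j) i := rfl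
    ext i j
    rw [hcol, hMS]
    fin_cases i <;> fin_cases j <;>
      simp [h.unit, h.tangent, h.unit_normal, h.orthogonal, lorentz_comm n]
  have hinv : M * (S * Mᵀ * G) = 1 := by
    rw [← Matrix.mul_assoc, ← Matrix.mul_assoc, hGram]
    ext i j
    fin_cases i <;> fin_cases j <;>
      simp [G, Matrix.mul_apply, Fin.sum_univ_four] <;> norm_num
  have hinv' := mul_eq_one_comm.1 hinv
  have hSt : Sᵀ = S := by
    ext i j
    fin_cases i <;> fin_cases j <;> simp [S]
  calc lorentz x y = x ⬝ᵥ ((S * Mᵀ * G * M) * S) *ᵥ y := by rw [hinv', one_mul, hS]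
    _ = ((M * S) *ᵥ x) ⬝ᵥ G *ᵥ ((M * S) *ᵥ y) := by
      rw [Matrix.dotProduct_mulVec, Matrix.dotProduct_mulVec, Matrix.vecMul_mulVec,
        Matrix.dotProduct_mulVec, Matrix.vecMul_vecMul, Matrix.transpose_mul, hSt]
      simp only [Matrix.mul_assoc]
    _ = _ := by
      rw [hMS, hMS]
      simp [G, dotProduct, Matrix.mulVec, Fin.sum_univ_four]; ring

lemma diskFun_normal_sq (h : IsTangentFrame v n) (z : ℂ) :
    diskFun n z ^ 2 = diskFun (v 0) z * diskFun (v 1) z + diskFun (v 1) z * diskFun (v 2) z +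
      diskFun (v 2) z * diskFun (v 0) z := by
  have := h.lorentz_eq (pointVec z) (pointVec z)
  rw [lorentz_pointVec_self] at this
  simp only [lorentz_pointVec] at this
  linear_combination -4 * this

lemma exists_diskFun_nonpos (h : IsTangentFrame v n) {z : ℂ} (hz : diskFun n z = 0) :
    ∃ j, diskFun (v j) z ≤ 0 := by
  by_contra! hpos
  have h0 := h.diskFun_normal_sq z
  have := mul_pos (hpos 0) (hpos 1)
  have := mul_pos (hpos 1) (hpos 2)
  have := mul_pos (hpos 2) (hpos 0)
  rw [hz] at h0
  linarith

/-- Descartes' theorem: a disk tangent to the three disks of a tangent frame is one of the two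
Soddy disks. -/
lemma diskFun_eq_of_tangent (h : IsTangentFrame v n) {u : Fin 4 → ℝ} (hu : lorentz u u = 1)
    (huv : ∀ j, lorentz (v j) u = -1) :
    ∃ t : ℝ, (t = 2 ∨ t = -2) ∧ ∀ z, diskFun u z =
      diskFun (v 0) z + diskFun (v 1) z + diskFun (v 2) z + t * diskFun n z := by
  refine ⟨lorentz n u, ?_, fun z ↦ ?_⟩
  · have := h.lorentz_eq u u
    rw [hu, huv, huv, huv] at this
    rw [← sq_eq_sq_iff_eq_or_eq_neg]
    linarith
  · have := h.lorentz_eq u (pointVec z)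
    simp only [lorentz_pointVec, huv] at this
    linarith

/-- The vector of the inner Soddy disk. -/
def soddyVec (v : Fin 3 → Fin 4 → ℝ) (n : Fin 4 → ℝ) : Fin 4 → ℝ :=
  fun i ↦ v 0 i + v 1 i + v 2 i + 2 * n i

lemma lorentz_soddyVec (x : Fin 4 → ℝ) : lorentz x (soddyVec v n) =
    lorentz x (v 0) + lorentz x (v 1) + lorentz x (v 2) + 2 * lorentz x n := by
  simp only [lorentz, soddyVec]; ring

lemma diskFun_soddyVec (z : ℂ) : diskFun (soddyVec v n) z =
    diskFun (v 0) z + diskFun (v 1) z + diskFun (v 2) z + 2 * diskFun n z := by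
  simp only [diskFun, soddyVec]; ring

lemma tangent_soddyVec (h : IsTangentFrame v n) (j : Fin 3) :
    lorentz (v j) (soddyVec v n) = -1 := by
  rw [lorentz_soddyVec, h.orthogonal]
  fin_cases j <;> simp [h.unit, h.tangent]

lemma unit_soddyVec (h : IsTangentFrame v n) : lorentz (soddyVec v n) (soddyVec v n) = 1 := by
  rw [lorentz_soddyVec]
  simp only [lorentz_comm (soddyVec v n), h.tangent_soddyVec]
  rw [lorentz_soddyVec, lorentz_comm n (v 0), lorentz_comm n (v 1), lorentz_comm n (v 2)]
  simp only [h.orthogonal, h.unit_normal]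
  norm_num

end IsTangentFrame

/-- The vector of the circle through the tangency points of three mutually tangent disks. -/
noncomputable def normalVec (v : Fin 3 → Fin 4 → ℝ) : Fin 4 → ℝ :=
  fun i ↦ (((v 1 2 + v 2 2) * v 0 i + (v 0 2 + v 2 2) * v 1 i + (v 0 2 + v 1 2) * v 2 i) / 2 -
    2 * ![0, 0, 0, 1] i) / kappa (v 0 2) (v 1 2) (v 2 2)

lemma lorentz_normalVec (x : Fin 4 → ℝ) (v : Fin 3 → Fin 4 → ℝ) : lorentz x (normalVec v) =
    (((v 1 2 + v 2 2) * lorentz x (v 0) + (v 0 2 + v 2 2) * lorentz x (v 1) +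
      (v 0 2 + v 1 2) * lorentz x (v 2)) / 2 + x 2) / kappa (v 0 2) (v 1 2) (v 2 2) := by
  simp [lorentz, normalVec]; ring

section normalVec

variable {v : Fin 3 → Fin 4 → ℝ}

lemma kappa_sq {a b c : ℝ} (h : 0 ≤ b * c + c * a + a * b) :
    kappa a b c ^ 2 = b * c + c * a + a * b := Real.sq_sqrt h

lemma normalVec_two (hpos : 0 < v 1 2 * v 2 2 + v 2 2 * v 0 2 + v 0 2 * v 1 2) :
    normalVec v 2 = kappa (v 0 2) (v 1 2) (v 2 2) := by
  have hκ : kappa (v 0 2) (v 1 2) (v 2 2) ≠ 0 := (Real.sqrt_pos.2 hpos).ne'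
  have hsq := kappa_sq hpos.le
  simp only [normalVec, Matrix.cons_val]
  field_simp
  linear_combination -2 * hsq

lemma isTangentFrame_normalVec (hu : ∀ j, lorentz (v j) (v j) = 1)
    (ht : ∀ j k, j ≠ k → lorentz (v j) (v k) = -1)
    (hpos : 0 < v 1 2 * v 2 2 + v 2 2 * v 0 2 + v 0 2 * v 1 2) :
    IsTangentFrame v (normalVec v) := by
  have hκ : kappa (v 0 2) (v 1 2) (v 2 2) ≠ 0 := (Real.sqrt_pos.2 hpos).ne'
  have horth (j : Fin 3) : lorentz (v j) (normalVec v) = 0 := by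
    rw [lorentz_normalVec, div_eq_zero_iff]
    left
    fin_cases j <;> simp [hu, ht] <;> ring
  refine ⟨hu, ht, ?_, horth⟩
  rw [lorentz_normalVec]
  simp only [lorentz_comm (normalVec v), horth]
  rw [normalVec_two hpos]
  field_simp
  ring

end normalVec

/-! ### Connectedness of the ideal triangle -/

section Klein

variable {ι E : Type*} [NormedAddCommGroup E] [InnerProductSpace ℝ E]

/-- An intersection of hyperbolic half-spaces of the Poincaré ball of radius `ρ` around `c` is
connected, being convex in the Klein model. -/
lemma isPreconnected_hyperbolic_polyhedron (c : E) {ρ : ℝ} (hρ : 0 < ρ) (k : ι → ℝ) (w : ι → E) :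
    IsPreconnected {z : E | ‖z - c‖ < ρ ∧
      ∀ j, 0 < k j * (‖z - c‖ ^ 2 + ρ ^ 2) - 2 * inner ℝ (w j) (z - c)} := by
  set C : Set E := Metric.ball 0 ρ ∩ ⋂ j, {y | inner ℝ (w j) y < k j * ρ ^ 2}
  let s : E → ℝ := fun y ↦ √(ρ ^ 2 - ‖y‖ ^ 2)
  let g : E → E := fun y ↦ c + (ρ / (ρ + s y)) • y
  have hs0 (y : E) : 0 ≤ s y := Real.sqrt_nonneg _
  have hC : Convex ℝ C := (convex_ball 0 ρ).inter <| convex_iInter fun j ↦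
    convex_halfSpace_lt (innerₛₗ ℝ (w j)).isLinear _
  have hg : Continuous g := by
    have hs : Continuous s := by fun_prop
    refine continuous_const.add (Continuous.smul ?_ continuous_id)
    exact continuous_const.div (continuous_const.add hs) fun y ↦ by have := hs0 y; positivity
  convert hC.isPreconnected.image g hg.continuousOn using 1
  ext z
  simp only [C, Set.mem_image, Set.mem_inter_iff, mem_ball_zero_iff, Set.mem_iInter,
    Set.mem_ofPred_eq]
  constructor
  · rintro ⟨hz, hj⟩
    set u := z - c with hu
    have hpos : 0 < ‖u‖ ^ 2 + ρ ^ 2 := by positivity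
    have hu2 : ‖u‖ ^ 2 < ρ ^ 2 := pow_lt_pow_left₀ hz (norm_nonneg _) two_ne_zero
    set a := 2 * ρ ^ 2 / (‖u‖ ^ 2 + ρ ^ 2) with ha
    have ha0 : 0 < a := by positivity
    have hna : ‖a • u‖ = a * ‖u‖ := by rw [norm_smul, Real.norm_of_nonneg ha0.le]
    have hsy : s (a • u) = ρ * (ρ ^ 2 - ‖u‖ ^ 2) / (‖u‖ ^ 2 + ρ ^ 2) := by
      have h0 : 0 ≤ ρ * (ρ ^ 2 - ‖u‖ ^ 2) / (‖u‖ ^ 2 + ρ ^ 2) := by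
        have : 0 ≤ ρ ^ 2 - ‖u‖ ^ 2 := by linarith
        positivity
      rw [← Real.sqrt_sq h0]
      simp only [s]
      rw [hna, ha]
      congr 1
      field_simp
      ring
    refine ⟨a • u, ⟨?_, fun j ↦ ?_⟩, ?_⟩
    · rw [hna, ha, div_mul_eq_mul_div, div_lt_iff₀ hpos]
      nlinarith [mul_pos hρ (pow_pos (sub_pos.2 hz) 2)]
    · rw [real_inner_smul_right, ha, div_mul_eq_mul_div, div_lt_iff₀ hpos]
      nlinarith [mul_pos (pow_pos hρ 2) (hj j)]
    · have h1 : ρ / (ρ + s (a • u)) * a = 1 := by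
        rw [hsy, ha]
        have hden : ρ + ρ * (ρ ^ 2 - ‖u‖ ^ 2) / (‖u‖ ^ 2 + ρ ^ 2) =
            2 * ρ ^ 3 / (‖u‖ ^ 2 + ρ ^ 2) := by
          field_simp
          ring
        rw [hden]
        field_simp
      simp only [g]
      rw [smul_smul, h1, one_smul, hu, add_sub_cancel]
  · rintro ⟨y, ⟨hy, hj⟩, rfl⟩
    have hy2 : ‖y‖ ^ 2 < ρ ^ 2 := pow_lt_pow_left₀ hy (norm_nonneg _) two_ne_zero
    have hsq : s y ^ 2 = ρ ^ 2 - ‖y‖ ^ 2 := Real.sq_sqrt (by linarith)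
    have hs : 0 < s y := Real.sqrt_pos.2 (by linarith)
    have hb : 0 < ρ / (ρ + s y) := by positivity
    have hnorm : ‖(ρ / (ρ + s y)) • y‖ = ρ / (ρ + s y) * ‖y‖ := by
      rw [norm_smul, Real.norm_of_nonneg hb.le]
    simp only [g, add_sub_cancel_left, hnorm, real_inner_smul_right]
    refine ⟨?_, fun j ↦ ?_⟩
    · rw [div_mul_eq_mul_div, div_lt_iff₀ (by positivity)]
      exact mul_lt_mul_of_pos_left (by linarith) hρ
    · have h1 : (ρ / (ρ + s y) * ‖y‖) ^ 2 + ρ ^ 2 = 2 * ρ ^ 2 * (ρ / (ρ + s y)) := by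
        have hy' : ‖y‖ ^ 2 = ρ ^ 2 - s y ^ 2 := by linarith
        rw [mul_pow, hy']
        field_simp
        ring
      rw [h1]
      nlinarith [mul_pos hb (sub_pos.2 (hj j))]

/-- Outside the ball of radius `ρ` around `c`, the complement of a set orthogonal to its boundary
sphere is stable under dilations with center `c`. -/
lemma hyperbolic_halfSpace_dilation {c w z : E} {ρ k s : ℝ} (hρ : 0 ≤ ρ) (hk : 0 ≤ k)
    (hz : ρ ≤ ‖z - c‖) (hs : 1 ≤ s) (h : 0 < k * (‖z - c‖ ^ 2 + ρ ^ 2) - 2 * inner ℝ w (z - c)) :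
    0 < k * (‖s • (z - c)‖ ^ 2 + ρ ^ 2) - 2 * inner ℝ w (s • (z - c)) := by
  have hs0 : 0 < s := by linarith
  have h1 : ρ ^ 2 ≤ ‖z - c‖ ^ 2 := pow_le_pow_left₀ hρ hz 2
  rw [norm_smul, Real.norm_of_nonneg hs0.le, real_inner_smul_right, mul_pow]
  have h2 : 0 ≤ k * ((s - 1) * (s * ‖z - c‖ ^ 2 - ρ ^ 2)) := by
    refine mul_nonneg hk (mul_nonneg (by linarith) ?_)
    nlinarith [sq_nonneg ‖z - c‖]
  nlinarith [mul_pos hs0 h]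

end Klein

lemma diskFun_eq_of_orthogonal {v n : Fin 4 → ℝ} (hn : 0 < n 2) (hnn : lorentz n n = 1)
    (hvn : lorentz v n = 0) (z : ℂ) :
    diskFun v z = v 2 * (‖z - vecCenter n‖ ^ 2 + (n 2)⁻¹ ^ 2) -
      2 * inner ℝ (⟨v 0 - v 2 * (vecCenter n).re, v 1 - v 2 * (vecCenter n).im⟩ : ℂ)
        (z - vecCenter n) := by
  simp only [lorentz] at hnn hvn
  simp only [norm_sq_eq_re_im, diskFun, Complex.inner, Complex.mul_re, Complex.conj_re,
    Complex.conj_im, Complex.sub_re, Complex.sub_im, vecCenter]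
  field_simp
  linear_combination v 2 * hnn - 2 * n 2 * hvn

namespace IsTangentFrame

variable {v : Fin 3 → Fin 4 → ℝ} {n : Fin 4 → ℝ}

lemma isPreconnected_triangle (h : IsTangentFrame v n) (hn : 0 < n 2) :
    IsPreconnected {z | diskFun n z < 0 ∧ ∀ j, 0 < diskFun (v j) z} := by
  convert isPreconnected_hyperbolic_polyhedron (vecCenter n) (inv_pos.2 hn) (fun j ↦ v j 2)
    (fun j ↦ (⟨v j 0 - v j 2 * (vecCenter n).re, v j 1 - v j 2 * (vecCenter n).im⟩ : ℂ))
    using 1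
  ext z
  have hball := Set.ext_iff.1 (setOf_diskFun_neg hn h.unit_normal) z
  rw [mem_ball_iff_norm, Set.mem_ofPred_eq] at hball
  simp only [Set.mem_ofPred_eq, hball,
    diskFun_eq_of_orthogonal hn h.unit_normal (h.orthogonal _)]

lemma connectedComponentIn_eq_triangle (h : IsTangentFrame v n) (hn : 0 < n 2) {z : ℂ}
    (hz : diskFun n z < 0) (hz' : ∀ j, 0 < diskFun (v j) z) :
    connectedComponentIn {z | ∀ j, 0 < diskFun (v j) z} z =
      {z | diskFun n z < 0 ∧ ∀ j, 0 < diskFun (v j) z} := by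
  apply Set.Subset.antisymm
  · have hsub := connectedComponentIn_subset {z | ∀ j, 0 < diskFun (v j) z} z
    have hleft : connectedComponentIn {z | ∀ j, 0 < diskFun (v j) z} z ⊆ {z | diskFun n z < 0} := by
      refine isPreconnected_connectedComponentIn.subset_left_of_subset_union
        (v := {z | 0 < diskFun n z})
        (isOpen_lt (continuous_diskFun n) continuous_const)
        (isOpen_lt continuous_const (continuous_diskFun n)) ?_ (fun y hy ↦ ?_)
        ⟨z, mem_connectedComponentIn hz', hz⟩
      · exact Set.disjoint_left.2 fun y (hy : diskFun n y < 0) (hy' : 0 < diskFun n y) ↦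
        lt_asymm hy hy'
      · rcases lt_trichotomy (diskFun n y) 0 with hlt | heq | hgt
        · exact Or.inl hlt
        · obtain ⟨j, hj⟩ := h.exists_diskFun_nonpos heq
          exact absurd (hsub hy j) hj.not_gt
        · exact Or.inr hgt
    exact fun y hy ↦ ⟨hleft hy, hsub hy⟩
  · exact (h.isPreconnected_triangle hn).subset_connectedComponentIn ⟨hz, hz'⟩ fun y hy ↦ hy.2

lemma not_isBounded_connectedComponentIn (h : IsTangentFrame v n) (hn : 0 < n 2)
    (hk : ∀ j, 0 ≤ v j 2) {z : ℂ} (hz : 0 ≤ diskFun n z) (hz' : ∀ j, 0 < diskFun (v j) z) :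
    ¬ Bornology.IsBounded (connectedComponentIn {z | ∀ j, 0 < diskFun (v j) z} z) := by
  set c := vecCenter n
  have hρ : 0 < (n 2)⁻¹ := inv_pos.2 hn
  have hzc : (n 2)⁻¹ ≤ ‖z - c‖ := by
    have hball := Set.ext_iff.1 (setOf_diskFun_neg hn h.unit_normal) z
    rw [mem_ball_iff_norm, Set.mem_ofPred_eq] at hball
    exact not_lt.1 fun hlt ↦ (hball.2 hlt).not_ge hz
  let ray : ℝ → ℂ := fun s ↦ c + s • (z - c)
  have hray : Continuous ray := by fun_prop
  have hsub : ray '' Set.Ici 1 ⊆ {z | ∀ j, 0 < diskFun (v j) z} := by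
    rintro _ ⟨s, hs, rfl⟩ j
    have hj := hz' j
    rw [diskFun_eq_of_orthogonal hn h.unit_normal (h.orthogonal _)] at hj ⊢
    rw [show ray s - vecCenter n = s • (z - c) from add_sub_cancel_left _ _]
    exact hyperbolic_halfSpace_dilation hρ.le (hk j) hzc hs hj
  have hcomp := ((isPreconnected_Ici (a := (1 : ℝ))).image ray
    hray.continuousOn).subset_connectedComponentIn (x := z)
    ⟨1, Set.self_mem_Ici, by simp [ray]⟩ hsub
  intro hb
  obtain ⟨R, hR⟩ := (hb.subset hcomp).subset_closedBall c
  have hR1 := hR ⟨max 1 ((R + 1) / ‖z - c‖), Set.mem_Ici.2 (le_max_left _ _), rfl⟩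
  rw [mem_closedBall_iff_norm, add_sub_cancel_left, norm_smul,
    Real.norm_of_nonneg (zero_le_one.trans (le_max_left _ _))] at hR1
  have hpos : 0 < ‖z - c‖ := hρ.trans_le hzc
  have := mul_le_mul_of_nonneg_right (le_max_right 1 ((R + 1) / ‖z - c‖)) hpos.le
  rw [div_mul_cancel₀ _ hpos.ne'] at this
  linarith

lemma setOf_soddyVec_subset (h : IsTangentFrame v n) (hk : ∀ j, 0 ≤ v j 2)
    (hs : 0 < soddyVec v n 2) :
    {z | diskFun (soddyVec v n) z < 0} ⊆ {z | diskFun n z < 0 ∧ ∀ j, 0 < diskFun (v j) z} := by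
  intro z hz
  have hpos (j : Fin 3) : 0 < diskFun (v j) z :=
    diskFun_pos_of_lorentz h.unit_soddyVec (h.unit j)
      (by rw [lorentz_comm, h.tangent_soddyVec]) (add_pos_of_pos_of_nonneg hs (hk j)) hz
  rw [Set.mem_ofPred_eq, diskFun_soddyVec] at hz
  refine ⟨?_, hpos⟩
  linarith [hpos 0, hpos 1, hpos 2]

lemma idealTriangle_eq (h : IsTangentFrame v n) (hn : 0 < n 2) {𝒟 : Fin 3 → Set ℂ}
    (hv : ∀ j, RepresentsDisk (v j) (𝒟 j)) (hs : 0 < soddyVec v n 2) :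
    idealTriangle 𝒟 = {z | diskFun n z < 0 ∧ ∀ j, 0 < diskFun (v j) z} := by
  have hk (j : Fin 3) : 0 ≤ v j 2 := (hv j).curv_nonneg
  have hU : (⋃ j, closure (𝒟 j))ᶜ = {z | ∀ j, 0 < diskFun (v j) z} := by
    ext z
    simp [(hv _).closure_eq]
  have hmem : vecCenter (soddyVec v n) ∈ {z | diskFun n z < 0 ∧ ∀ j, 0 < diskFun (v j) z} := by
    apply h.setOf_soddyVec_subset hk hs
    rw [setOf_diskFun_neg hs h.unit_soddyVec]
    exact Metric.mem_ball_self (inv_pos.2 hs)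
  have hbdd : Bornology.IsBounded {z | diskFun n z < 0 ∧ ∀ j, 0 < diskFun (v j) z} := by
    have hb : Bornology.IsBounded {z | diskFun n z < 0} := by
      rw [setOf_diskFun_neg hn h.unit_normal]
      exact Metric.isBounded_ball
    exact hb.subset fun z hz ↦ hz.1
  have hex : ∃ T : Set ℂ, Bornology.IsBounded T ∧ ∃ z ∈ (⋃ j, closure (𝒟 j))ᶜ,
      T = connectedComponentIn (⋃ j, closure (𝒟 j))ᶜ z := by
    refine ⟨_, hbdd, vecCenter (soddyVec v n), hU ▸ hmem.2, ?_⟩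
    rw [hU, h.connectedComponentIn_eq_triangle hn hmem.1 hmem.2]
  obtain ⟨hb, z, hz, hT⟩ := Classical.epsilon_spec hex
  change Bornology.IsBounded (idealTriangle 𝒟) at hb
  change idealTriangle 𝒟 = _ at hT
  rw [hU] at hT hz
  rw [hT] at hb ⊢
  rcases lt_or_ge (diskFun n z) 0 with hlt | hge
  · exact h.connectedComponentIn_eq_triangle hn hlt hz
  · exact absurd hb (h.not_isBounded_connectedComponentIn hn hk hge hz)

/-- The inscribed disk of the ideal triangle is the inner Soddy disk. -/
lemma isInscribedDisk_iff (h : IsTangentFrame v n) (hn : 0 < n 2) {𝒟 : Fin 3 → Set ℂ}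
    (hv : ∀ j, RepresentsDisk (v j) (𝒟 j)) (hs : 0 < soddyVec v n 2) (D : Set ℂ) :
    IsInscribedDisk 𝒟 D ↔ D = {z | diskFun (soddyVec v n) z < 0} := by
  rw [IsInscribedDisk, h.idealTriangle_eq hn hv hs]
  constructor
  · rintro ⟨hD, hsub, htan⟩
    obtain ⟨u, hu, hu2⟩ := hD.exists_represents
    obtain ⟨t, ht, hf⟩ := h.diskFun_eq_of_tangent hu.unit fun j ↦ by
      rw [lorentz_comm]
      exact lorentz_eq_neg_one hu (hv j) (Or.inl hu2) (htan j)
    rcases ht with rfl | rfl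
    · rw [hu.eq_setOf]
      simp only [hf, diskFun_soddyVec]
    · have hc : vecCenter u ∈ D := by
        rw [hu.eq_setOf, setOf_diskFun_neg hu2 hu.unit]
        exact Metric.mem_ball_self (inv_pos.2 hu2)
      have hneg : diskFun u (vecCenter u) < 0 := by
        have := hc
        rwa [hu.eq_setOf] at this
      obtain ⟨h1, h2⟩ := hsub hc
      rw [hf] at hneg
      linarith [h2 0, h2 1, h2 2]
  · rintro rfl
    refine ⟨⟨_, _, inv_pos.2 hs, setOf_diskFun_neg hs h.unit_soddyVec⟩,
      h.setOf_soddyVec_subset (fun j ↦ (hv j).curv_nonneg) hs,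
      fun j ↦ ⟨contactPoint (soddyVec v n) (v j), ?_⟩⟩
    exact closure_inter_closure_of_lorentz (represents_setOf hs h.unit_soddyVec) (hv j) hs
      (by rw [lorentz_comm, h.tangent_soddyVec])

end IsTangentFrame

/-- The members of a tangential disk triple are represented by mutually tangent vectors, at most
one of which has vanishing curvature. -/
lemma IsTDT.exists_represents {𝒟 : Fin 3 → Set ℂ} (h𝒟 : IsTDT 𝒟) :
    ∃ v : Fin 3 → Fin 4 → ℝ, (∀ j, RepresentsDisk (v j) (𝒟 j)) ∧
      (∀ j k, j ≠ k → lorentz (v j) (v k) = -1) ∧ ∀ j k, j ≠ k → 0 < v j 2 ∨ 0 < v k 2 := by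
  obtain ⟨hD, htan⟩ := h𝒟
  have hex : ∃ i, ∀ j, ∃ v, RepresentsDisk v (𝒟 j) ∧ (j ≠ i → 0 < v 2) := by
    rcases hD with hD | ⟨i, hi, hD⟩
    · refine ⟨0, fun j ↦ ?_⟩
      obtain ⟨v, hv, hpos⟩ := (hD j).exists_represents
      exact ⟨v, hv, fun _ ↦ hpos⟩
    · refine ⟨i, fun j ↦ ?_⟩
      by_cases hj : j = i
      · obtain ⟨v, hv, -⟩ := hi.exists_represents
        exact ⟨v, hj ▸ hv, fun hne ↦ absurd hj hne⟩
      · obtain ⟨v, hv, hpos⟩ := (hD j hj).exists_represents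
        exact ⟨v, hv, fun _ ↦ hpos⟩
  obtain ⟨i, hi⟩ := hex
  choose v hv hpos using hi
  have hor (j k : Fin 3) (hjk : j ≠ k) : 0 < v j 2 ∨ 0 < v k 2 := by
    by_cases hj : j = i
    · exact Or.inr (hpos k fun hk ↦ hjk (hj.trans hk.symm))
    · exact Or.inl (hpos j hj)
  exact ⟨v, hv, fun j k hjk ↦ lorentz_eq_neg_one (hv j) (hv k) (hor j k hjk) (htan j k hjk), hor⟩

/-- existence and uniqueness of the inscribed disk of the ideal triangle,
and the value of its curvature. -/
theorem inscribedDisk_existsUnique_and_curv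
    (𝒟 : Fin 3 → Set ℂ) (h𝒟 : IsTDTplus 𝒟) :
    (∃! D : Set ℂ, IsInscribedDisk 𝒟 D) ∧
    curv (Din 𝒟) =
      curv (𝒟 0) + curv (𝒟 1) + curv (𝒟 2) +
        2 * kappa (curv (𝒟 0)) (curv (𝒟 1)) (curv (𝒟 2)) := by
  obtain ⟨v, hv, htan, hor⟩ := IsTDT.exists_represents h𝒟.1
  have hk (j : Fin 3) : 0 ≤ v j 2 := (hv j).curv_nonneg
  have hpos : 0 < v 1 2 * v 2 2 + v 2 2 * v 0 2 + v 0 2 * v 1 2 := by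
    have h01 := mul_nonneg (hk 0) (hk 1)
    have h12 := mul_nonneg (hk 1) (hk 2)
    have h20 := mul_nonneg (hk 2) (hk 0)
    rcases hor 0 1 (by decide) with h0 | h1
    · rcases hor 1 2 (by decide) with h1 | h2
      · linarith [mul_pos h0 h1]
      · linarith [mul_pos h2 h0]
    · rcases hor 2 0 (by decide) with h2 | h0
      · linarith [mul_pos h1 h2]
      · linarith [mul_pos h0 h1]
  have hframe := isTangentFrame_normalVec (fun j ↦ (hv j).unit) htan hpos
  have hn2 := normalVec_two hpos
  have hn : 0 < normalVec v 2 := hn2 ▸ Real.sqrt_pos.2 hpos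
  have hs : 0 < IsTangentFrame.soddyVec v (normalVec v) 2 := by
    have := hk 0
    have := hk 1
    have := hk 2
    simp only [IsTangentFrame.soddyVec]
    positivity
  have hiff := hframe.isInscribedDisk_iff hn hv hs
  refine ⟨⟨_, (hiff _).2 rfl, fun D hD ↦ (hiff D).1 hD⟩, ?_⟩
  have hDin : Din 𝒟 = {z | diskFun (IsTangentFrame.soddyVec v (normalVec v)) z < 0} :=
    (hiff _).1 (Classical.epsilon_spec ⟨_, (hiff _).2 rfl⟩)
  rw [hDin, (represents_setOf hs hframe.unit_soddyVec).curv_eq, (hv 0).curv_eq, (hv 1).curv_eq,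
    (hv 2).curv_eq, ← hn2]
  rfl
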